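/- arXiv:2012.14667 — 2 statements merged into one kernel-verified Lean document; each statement's English description precedes it below -/
import Mathlib

section
/- Let K be a closed strongly connected n-dimensional pseudo-manifold. Then the barycentric subdivision Sd(K) carries a shellable Morse tiling which uses exactly one tile of order 0 (a closed simplex), at least one open simplex, and no tile of order 0 other than that unique closed simplex. -/
open Finset

variable {V : Type*} [DecidableEq V]

/-- A finite simplicial complex: a finite collection of finite sets of vertices
closed under taking subsets. -/
def IsComplex (K : Finset (Finset V)) : Prop :=
  ∀ σ ∈ K, ∀ τ ⊆ σ, τ ∈ K

/-- The set of nonempty faces of the relative simplicial complex `K ∖ L`. -/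
def relFaces (K L : Finset (Finset V)) : Finset (Finset V) :=
  (K \ L).filter (fun τ => τ ≠ ∅)

/-- A set `A` of faces is closed in `S`: every nonempty face of `S` contained in a
member of `A` belongs to `A`. -/
def closedIn (S A : Finset (Finset V)) : Prop :=
  ∀ τ ∈ S, τ ≠ ∅ → ∀ α ∈ A, τ ⊆ α → τ ∈ A

/-- A facet: a maximal face. -/
def IsFacetOf (K : Finset (Finset V)) (θ : Finset V) : Prop :=
  θ ∈ K ∧ ∀ σ ∈ K, θ ⊆ σ → σ = θ

instance (K : Finset (Finset V)) (θ : Finset V) : Decidable (IsFacetOf K θ) :=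
  inferInstanceAs (Decidable (θ ∈ K ∧ ∀ σ ∈ K, θ ⊆ σ → σ = θ))

/-- A ridge: a face of codimension one in every facet containing it. -/
def IsRidgeOf (K : Finset (Finset V)) (θ : Finset V) : Prop :=
  θ ∈ K ∧ ∀ σ, IsFacetOf K σ → θ ⊆ σ → σ.card = θ.card + 1

/-- Stellar subdivision of `K` at the face `θ`, using the new vertex `v`. -/
def stellar (K : Finset (Finset V)) (θ : Finset V) (v : V) : Finset (Finset V) :=
  K.filter (fun σ => ¬ θ ⊆ σ) ∪
    (K.filter (fun ρ => ¬ θ ⊆ ρ ∧ ρ ∪ θ ∈ K)).image (fun ρ => insert v ρ)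

/-- Barycentric subdivision: faces are the chains of nonempty faces of `K`. -/
def barySd (K : Finset (Finset V)) : Finset (Finset (Finset V)) :=
  K.powerset.filter (fun c => ∅ ∉ c ∧ ∀ τ ∈ c, ∀ τ' ∈ c, τ ⊆ τ' ∨ τ' ⊆ τ)

/-- A Morse tile: a simplex `simplex` deprived of the ridges not containing `res`,
together possibly with a Morse face `morse` of higher codimension. -/
structure MorseTile (V : Type*) where
  simplex : Finset V
  res : Finset V
  morse : Option (Finset V)
  simplex_nonempty : simplex.Nonempty
  res_sub : res ⊆ simplex
  morse_res : ∀ μ ∈ morse, res ⊆ μ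
  morse_ssub : ∀ μ ∈ morse, μ ⊂ simplex
  morse_card : ∀ μ ∈ morse, μ.card + 2 ≤ simplex.card

namespace MorseTile

/-- The face set of a Morse tile. -/
def faceSet (T : MorseTile V) : Finset (Finset V) :=
  match T.morse with
  | none => T.simplex.powerset.filter (fun τ => T.res ⊆ τ ∧ τ ≠ ∅)
  | some μ => T.simplex.powerset.filter (fun τ => T.res ⊆ τ ∧ ¬ τ ⊆ μ)

/-- The dimension of a Morse tile. -/
def dim (T : MorseTile V) : ℕ := T.simplex.card - 1

/-- The order of a Morse tile. -/
def order (T : MorseTile V) : ℕ := T.res.card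

/-- The index of a (critical) Morse tile. -/
def index (T : MorseTile V) : ℕ :=
  if T.res = T.simplex then T.simplex.card - 1 else T.res.card

/-- Basic tiles: no Morse face. -/
def IsBasic (T : MorseTile V) : Prop := T.morse = none

/-- Critical tiles: the Morse face equals the restriction set, or the open simplex. -/
def IsCritical (T : MorseTile V) : Prop := T.morse = some T.res ∨ T.res = T.simplex

/-- Tiles allowed in an h-tiling: basic or critical tiles. -/
def IsHTile (T : MorseTile V) : Prop := T.morse = none ∨ T.morse = some T.res

/-- The closed simplex. -/
def IsClosedSimplex (T : MorseTile V) : Prop := T.morse = none ∧ T.res = ∅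

/-- The open simplex. -/
def IsOpenSimplex (T : MorseTile V) : Prop := T.morse = none ∧ T.res = T.simplex

instance (T : MorseTile V) : Decidable T.IsCritical :=
  inferInstanceAs (Decidable (T.morse = some T.res ∨ T.res = T.simplex))

/-- Isomorphism of Morse tiles: a bijection between the underlying simplices mapping
the face set of one onto the face set of the other. -/
def Isom (T T' : MorseTile V) : Prop :=
  ∃ e : V → V, Set.InjOn e (T.simplex : Set V) ∧ T.simplex.image e = T'.simplex ∧
    T.faceSet.image (fun τ => τ.image e) = T'.faceSet

/-- The subcomplex `L_T` of removed faces of a Morse tile. -/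
def removed (T : MorseTile V) : Finset (Finset V) :=
  T.simplex.powerset.filter (fun τ => τ ∉ T.faceSet)

/-- The stellar subdivision of a Morse tile at a face `θ` of its underlying simplex,
as a relative simplicial complex. -/
def stellarSub (T : MorseTile V) (θ : Finset V) (v : V) : Finset (Finset V) :=
  relFaces (stellar T.simplex.powerset θ v) (stellar T.removed θ v)

end MorseTile

/-- The union of the face sets of a list of Morse tiles. -/
def faceUnion (ts : List (MorseTile V)) : Finset (Finset V) :=
  ts.foldr (fun T A => T.faceSet ∪ A) ∅

/-- A Morse tiling of the set `S` of nonempty faces of a relative complex: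
the face sets of the tiles partition `S`, and for every `d` the union of the
face sets of the tiles of dimension at least `d` is closed in `S`. -/
def IsMorseTiling (S : Finset (Finset V)) (ts : List (MorseTile V)) : Prop :=
  ts.Pairwise (fun T T' => Disjoint T.faceSet T'.faceSet) ∧
  faceUnion ts = S ∧
  ∀ d : ℕ, closedIn S (faceUnion (ts.filter (fun T => decide (d ≤ T.dim))))

/-- A Morse shelling: a Morse tiling whose order makes every initial union closed. -/
def IsMorseShelling (S : Finset (Finset V)) (ts : List (MorseTile V)) : Prop :=
  IsMorseTiling S ts ∧ ∀ p : ℕ, closedIn S (faceUnion (ts.take p))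

/-- An h-tiling: a Morse tiling all of whose tiles are basic or critical. -/
def IsHTiling (S : Finset (Finset V)) (ts : List (MorseTile V)) : Prop :=
  IsMorseTiling S ts ∧ ∀ T ∈ ts, T.IsHTile

/-- A shellable (shelled) h-tiling. -/
def IsHShelling (S : Finset (Finset V)) (ts : List (MorseTile V)) : Prop :=
  IsMorseShelling S ts ∧ ∀ T ∈ ts, T.IsHTile

/-- The number of critical tiles of index `k`. -/
def criticalCount (ts : List (MorseTile V)) (k : ℕ) : ℕ :=
  ts.countP (fun T => decide (T.IsCritical ∧ T.index = k))

/-- The total number of critical tiles. -/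
def totalCritical (ts : List (MorseTile V)) : ℕ :=
  ts.countP (fun T => decide T.IsCritical)

/-- The number of tiles of order `k`. -/
def hCount (ts : List (MorseTile V)) (k : ℕ) : ℕ :=
  ts.countP (fun T => decide (T.order = k))

/-- The number of `k`-dimensional faces. -/
def fCount (S : Finset (Finset V)) (k : ℕ) : ℕ :=
  (S.filter (fun τ => τ.card = k + 1)).card

/-- The Euler characteristic of a set of nonempty faces. -/
def eulerChar (S : Finset (Finset V)) : ℤ :=
  ∑ τ ∈ S, (-1 : ℤ) ^ (τ.card - 1)

/-- A pure `n`-dimensional complex: it has an `n`-dimensional face and all its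
facets have dimension `n`. -/
def IsPureDim (n : ℕ) (K : Finset (Finset V)) : Prop :=
  (∃ σ ∈ K, σ.card = n + 1) ∧ ∀ θ, IsFacetOf K θ → θ.card = n + 1

/-- A closed `n`-dimensional pseudo-manifold: a pure `n`-dimensional complex in
which every `(n-1)`-dimensional face is contained in exactly two facets. -/
def IsPseudoManifold (n : ℕ) (K : Finset (Finset V)) : Prop :=
  IsComplex K ∧ IsPureDim n K ∧
  ∀ ρ ∈ K, ρ.card = n → (K.filter (fun σ => IsFacetOf K σ ∧ ρ ⊆ σ)).card = 2

/-- Strong connectedness: any two facets are joined by a sequence of facets in which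
consecutive ones share an `(n-1)`-dimensional face. -/
def StronglyConnected (n : ℕ) (K : Finset (Finset V)) : Prop :=
  ∀ σ σ', IsFacetOf K σ → IsFacetOf K σ' →
    ∃ (m : ℕ) (c : ℕ → Finset V), c 0 = σ ∧ c m = σ' ∧
      (∀ i ≤ m, IsFacetOf K (c i)) ∧
      ∀ i < m, ∃ ρ : Finset V, ρ.card = n ∧ ρ ⊆ c i ∧ ρ ⊆ c (i + 1)

/-- Classical shellability of a finite simplicial complex. -/
def ClassicallyShellable (K : Finset (Finset V)) : Prop :=
  ∃ (N : ℕ) (f : Fin N → Finset V), Function.Injective f ∧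
    (∀ σ, IsFacetOf K σ ↔ ∃ i, f i = σ) ∧
    ∀ p : Fin N, 0 < (p : ℕ) →
      ∃ R : Finset V, R ≠ ∅ ∧ R ⊆ f p ∧
        ∀ τ : Finset V,
          ((τ ≠ ∅ ∧ τ ⊆ f p ∧ ∀ q, q < p → ¬ τ ⊆ f q) ↔ (R ⊆ τ ∧ τ ⊆ f p))

/-! ### Shellings obtained from an ordering of the facets -/

theorem mem_faceUnion {ts : List (MorseTile V)} {τ : Finset V} :
    τ ∈ faceUnion ts ↔ ∃ T ∈ ts, τ ∈ T.faceSet := by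
  induction ts with
  | nil => simp [faceUnion]
  | cons T ts ih =>
    have h : faceUnion (T :: ts) = T.faceSet ∪ faceUnion ts := rfl
    simp [h, ih]

/-- If the facets in `F` are ordered by `Φ` and the faces of each facet which lie in no
preceding facet form a Morse tile, then these tiles form a shelling. -/
theorem exists_isMorseShelling_of_ordering {α : Type*} [LinearOrder α]
    (S F : Finset (Finset V)) (Φ : Finset V → α) (T : Finset V → MorseTile V) (m : ℕ)
    (hdim : ∀ C ∈ F, (T C).dim = m)
    (hsub : ∀ C ∈ F, ∀ τ ∈ (T C).faceSet, τ ≠ ∅ ∧ τ ⊆ C ∧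
      ∀ C' ∈ F, C' ≠ C → Φ C' ≤ Φ C → ¬ τ ⊆ C')
    (hnew : ∀ C ∈ F, ∀ τ, τ ≠ ∅ → τ ⊆ C → (∀ C' ∈ F, Φ C' < Φ C → ¬ τ ⊆ C') →
      τ ∈ (T C).faceSet)
    (hS : ∀ τ, τ ∈ S ↔ τ ≠ ∅ ∧ ∃ C ∈ F, τ ⊆ C) :
    ∃ ts : List (MorseTile V), IsMorseShelling S ts ∧ ∀ t, t ∈ ts ↔ ∃ C ∈ F, T C = t := by
  classical
  let le : Finset V → Finset V → Prop := fun C C' => Φ C ≤ Φ C'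
  have : Std.Total le := ⟨fun a b => le_total (Φ a) (Φ b)⟩
  have : IsTrans _ le := ⟨fun a b c => le_trans (a := Φ a)⟩
  let l := F.toList.insertionSort le
  have hl : l.Pairwise le := List.pairwise_insertionSort le _
  have hmem : ∀ C, C ∈ l ↔ C ∈ F := by simp [l]
  have hnd : l.Nodup := (List.perm_insertionSort le _).nodup_iff.2 F.nodup_toList
  have hmin : ∀ C ∈ F, ∀ τ, τ ≠ ∅ → τ ⊆ C →
      ∃ C' ∈ F, τ ∈ (T C').faceSet ∧ (C' = C ∨ Φ C' < Φ C) := by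
    intro C hC τ hτ hτC
    by_cases hold : ∀ C' ∈ F, Φ C' < Φ C → ¬ τ ⊆ C'
    · exact ⟨C, hC, hnew C hC τ hτ hτC hold, Or.inl rfl⟩
    · push Not at hold
      obtain ⟨C₁, hC₁, hlt, hsub₁⟩ := hold
      obtain ⟨C₂, hC₂, hC₂min⟩ := (F.filter (τ ⊆ ·)).exists_min_image Φ
        ⟨C₁, mem_filter.2 ⟨hC₁, hsub₁⟩⟩
      rw [mem_filter] at hC₂
      refine ⟨C₂, hC₂.1, hnew C₂ hC₂.1 τ hτ hC₂.2 ?_,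
        Or.inr ((hC₂min C₁ (mem_filter.2 ⟨hC₁, hsub₁⟩)).trans_lt hlt)⟩
      intro C' hC' hlt' hsub'
      exact absurd (hC₂min C' (mem_filter.2 ⟨hC', hsub'⟩)) (not_le.2 hlt')
  have hunion : faceUnion (l.map T) = S := by
    ext τ
    simp only [mem_faceUnion, List.mem_map, hS]
    constructor
    · rintro ⟨_, ⟨C, hC, rfl⟩, hτ⟩
      have h := hsub C ((hmem C).1 hC) τ hτ
      exact ⟨h.1, C, (hmem C).1 hC, h.2.1⟩
    · rintro ⟨hτ, C, hC, hτC⟩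
      obtain ⟨C', hC', h, -⟩ := hmin C hC τ hτ hτC
      exact ⟨_, ⟨C', (hmem C').2 hC', rfl⟩, h⟩
  refine ⟨l.map T, ⟨⟨?_, hunion, ?_⟩, ?_⟩, fun t => by simp [hmem]⟩
  · rw [List.pairwise_map]
    refine (hl.and hnd).imp_of_mem ?_
    rintro C C' hC hC' ⟨hle, hne⟩
    rw [Finset.disjoint_left]
    intro τ hτ hτ'
    exact (hsub C' ((hmem _).1 hC') τ hτ').2.2 C ((hmem _).1 hC) hne hle
      (hsub C ((hmem _).1 hC) τ hτ).2.1
  · intro d τ hτS hτ α hα hτα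
    by_cases hd : d ≤ m
    · rw [List.filter_eq_self.2, hunion]
      · exact hτS
      · intro t ht
        obtain ⟨C, hC, rfl⟩ := List.mem_map.1 ht
        simpa [hdim C ((hmem C).1 hC)] using hd
    · obtain ⟨t, ht, -⟩ := mem_faceUnion.1 hα
      rw [List.mem_filter] at ht
      obtain ⟨C, hC, rfl⟩ := List.mem_map.1 ht.1
      exact absurd (of_decide_eq_true ht.2) (by rwa [hdim C ((hmem C).1 hC)])
  · intro p τ hτS hτ α hα hτα
    rw [← List.map_take] at hα ⊢
    obtain ⟨t, ht, hαt⟩ := mem_faceUnion.1 hα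
    obtain ⟨C, hC, rfl⟩ := List.mem_map.1 ht
    have hCF : C ∈ F := (hmem C).1 (List.mem_of_mem_take hC)
    obtain ⟨C', hC', hτC', h⟩ := hmin C hCF τ hτ (hτα.trans (hsub C hCF α hαt).2.1)
    refine mem_faceUnion.2 ⟨T C', List.mem_map.2 ⟨C', ?_, rfl⟩, hτC'⟩
    rcases h with rfl | h
    · exact hC
    · have hC'l := (hmem C').2 hC'
      rw [← List.take_append_drop p l] at hC'l hl
      rcases List.mem_append.1 hC'l with h' | h'
      · exact h'
      · exact absurd ((List.pairwise_append.1 hl).2.2 C hC C' h') (not_le.2 h)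

/-! ### Flags of subsets of a finite set and their inversions -/

/-- A flag of nonempty subsets of `σ`. -/
def IsFlag (σ : Finset V) (c : Finset (Finset V)) : Prop :=
  ∅ ∉ c ∧ (∀ A ∈ c, A ⊆ σ) ∧ ∀ A ∈ c, ∀ B ∈ c, A ⊆ B ∨ B ⊆ A

/-- A complete flag of nonempty subsets of `σ`. -/
def IsFullFlag (σ : Finset V) (c : Finset (Finset V)) : Prop :=
  IsFlag σ c ∧ c.card = σ.card

/-- The pairs of elements of `σ` which the flag `c` separates in the order opposite to `r`. -/
def flagInversions {β : Type*} [LinearOrder β] (r : V → β) (σ : Finset V)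
    (c : Finset (Finset V)) : Finset (V × V) :=
  (σ ×ˢ σ).filter (fun q => r q.1 < r q.2 ∧ ∃ A ∈ c, q.2 ∈ A ∧ q.1 ∉ A)

/-- The members of a flag whose deletion loses an inversion. -/
def flagDescents {β : Type*} [LinearOrder β] (r : V → β) (σ : Finset V)
    (c : Finset (Finset V)) : Finset (Finset V) :=
  c.filter (fun A => flagInversions r σ (c.erase A) ≠ flagInversions r σ c)

section Flags

variable {β : Type*} [LinearOrder β] {r : V → β} {σ : Finset V} {c d : Finset (Finset V)}

theorem mem_flagInversions {x y : V} : (x, y) ∈ flagInversions r σ c ↔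
    (x ∈ σ ∧ y ∈ σ) ∧ r x < r y ∧ ∃ A ∈ c, y ∈ A ∧ x ∉ A := by
  simp [flagInversions]

theorem flagInversions_mono (h : c ⊆ d) : flagInversions r σ c ⊆ flagInversions r σ d := by
  rintro ⟨x, y⟩ hxy
  rw [mem_flagInversions] at hxy ⊢
  obtain ⟨h₁, h₂, A, hA, h₃⟩ := hxy
  exact ⟨h₁, h₂, A, h hA, h₃⟩

theorem flagDescents_subset : flagDescents r σ c ⊆ c := filter_subset _ _

theorem IsFlag.mono (hd : IsFlag σ d) (h : c ⊆ d) : IsFlag σ c :=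
  ⟨fun h0 => hd.1 (h h0), fun A hA => hd.2.1 A (h hA),
    fun A hA B hB => hd.2.2 A (h hA) B (h hB)⟩

theorem IsFlag.exists_greatest (hc : IsFlag σ c) (h : c.Nonempty) :
    ∃ A ∈ c, ∀ B ∈ c, B ⊆ A := by
  obtain ⟨A, hA, hmax⟩ := c.exists_max_image Finset.card h
  refine ⟨A, hA, fun B hB => ?_⟩
  rcases hc.2.2 A hA B hB with h | h
  · exact (eq_of_subset_of_card_le h (hmax B hB)).ge
  · exact h

/-- Every flag extends to a complete flag without creating inversions. -/
theorem IsFlag.exists_isFullFlag (hc : IsFlag σ c) (hr : Set.InjOn r σ) :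
    ∃ d, IsFullFlag σ d ∧ c ⊆ d ∧ flagInversions r σ d = flagInversions r σ c := by
  let k : V → ℕ ×ₗ β := fun x => toLex ((c.filter (x ∉ ·)).card, r x)
  have hk : Set.InjOn k σ := fun x hx y hy hxy => hr hx hy (by
    have := congrArg (fun q => (ofLex q).2) hxy
    simpa [k] using this)
  have hlt : ∀ x y, (∃ A ∈ c, x ∈ A ∧ y ∉ A) →
      (c.filter (x ∉ ·)).card < (c.filter (y ∉ ·)).card := by
    rintro x y ⟨A, hA, hx, hy⟩
    apply card_lt_card
    rw [ssubset_iff_of_subset]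
    · exact ⟨A, by simp [hA, hy], by simp [hx]⟩
    · intro B hB
      rw [mem_filter] at hB ⊢
      refine ⟨hB.1, fun hyB => ?_⟩
      rcases hc.2.2 A hA B hB.1 with h | h
      · exact hB.2 (h hx)
      · exact hy (h hyB)
  have hlt' : ∀ x y, (c.filter (x ∉ ·)).card < (c.filter (y ∉ ·)).card →
      ∃ A ∈ c, x ∈ A ∧ y ∉ A := by
    intro x y h
    by_contra! hcon
    refine absurd (card_le_card ?_) (not_le.2 h)
    intro A hA
    rw [mem_filter] at hA ⊢
    exact ⟨hA.1, fun hx => hA.2 (hcon A hA.1 hx)⟩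
  let f : V → Finset V := fun x => σ.filter (fun z => k z ≤ k x)
  have hsub : c ⊆ σ.image f := by
    intro A hA
    have hne : A.Nonempty := nonempty_iff_ne_empty.2 fun h => hc.1 (h ▸ hA)
    obtain ⟨x, hx, hmax⟩ := A.exists_max_image k hne
    refine mem_image.2 ⟨x, hc.2.1 A hA hx, ?_⟩
    ext z
    simp only [f, mem_filter]
    refine ⟨fun ⟨_, hz⟩ => ?_, fun hz => ⟨hc.2.1 A hA hz, hmax z hz⟩⟩
    by_contra hzA
    refine absurd hz (not_le.2 ?_)
    exact Prod.Lex.toLex_lt_toLex.2 (Or.inl (hlt x z ⟨A, hA, hx, hzA⟩))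
  have hinj : Set.InjOn f σ := by
    intro x hx y hy hxy
    have h₁ : x ∈ f y := by rw [← hxy]; simpa [f] using hx
    have h₂ : y ∈ f x := by rw [hxy]; simpa [f] using hy
    exact hk hx hy (le_antisymm (mem_filter.1 h₁).2 (mem_filter.1 h₂).2)
  refine ⟨σ.image f, ⟨⟨?_, ?_, ?_⟩, card_image_of_injOn hinj⟩, hsub,
    (flagInversions_mono hsub).antisymm' ?_⟩
  · intro h
    obtain ⟨x, hx, h⟩ := mem_image.1 h
    have : x ∈ f x := by simpa [f] using hx
    rw [h] at this
    exact notMem_empty x this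
  · intro A hA
    obtain ⟨x, -, rfl⟩ := mem_image.1 hA
    exact filter_subset _ _
  · intro A hA B hB
    obtain ⟨x, -, rfl⟩ := mem_image.1 hA
    obtain ⟨y, -, rfl⟩ := mem_image.1 hB
    rcases le_total (k x) (k y) with h | h
    · exact Or.inl (monotone_filter_right _ fun z _ hz => hz.trans h)
    · exact Or.inr (monotone_filter_right _ fun z _ hz => hz.trans h)
  · rintro ⟨x, y⟩ hxy
    rw [mem_flagInversions] at hxy ⊢
    obtain ⟨⟨hx, hy⟩, hrxy, A, hA, hyA, hxA⟩ := hxy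
    refine ⟨⟨hx, hy⟩, hrxy, hlt' y x ?_⟩
    obtain ⟨z, -, rfl⟩ := mem_image.1 hA
    have hyz : k y ≤ k z := (mem_filter.1 hyA).2
    have hzx : k z < k x := not_le.1 fun h => hxA (mem_filter.2 ⟨hx, h⟩)
    rcases Prod.Lex.toLex_lt_toLex.1 (hyz.trans_lt hzx) with h | h
    · exact h
    · exact absurd h.2 hrxy.le.not_gt

theorem IsFullFlag.eq_of_subset (hc : IsFullFlag σ c) (hd : IsFlag σ d) (h : c ⊆ d) :
    c = d := by
  obtain ⟨r, hr⟩ : ∃ r : V → ℕ, Set.InjOn r σ :=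
    ⟨fun x => σ.toList.idxOf x, fun x hx y _ h =>
      (List.idxOf_inj (by simpa using hx)).1 h⟩
  obtain ⟨e, he, hde, -⟩ := hd.exists_isFullFlag hr
  exact eq_of_subset_of_card_le h (by rw [hc.2, ← he.2]; exact card_le_card hde)

theorem IsFullFlag.self_mem (hc : IsFullFlag σ c) (hσ : σ.Nonempty) : σ ∈ c := by
  have h : IsFlag σ (insert σ c) := by
    refine ⟨?_, ?_, ?_⟩
    · rw [mem_insert]
      rintro (h | h)
      · exact hσ.ne_empty h.symm
      · exact hc.1.1 h
    · intro A hA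
      rcases mem_insert.1 hA with rfl | hA
      · exact Subset.rfl
      · exact hc.1.2.1 A hA
    · intro A hA B hB
      rcases mem_insert.1 hA with hAσ | hAc
      · rcases mem_insert.1 hB with hBσ | hBc
        · exact Or.inl (hAσ.trans hBσ.symm).subset
        · exact Or.inr (hAσ ▸ hc.1.2.1 B hBc)
      · rcases mem_insert.1 hB with hBσ | hBc
        · exact Or.inl (hBσ ▸ hc.1.2.1 A hAc)
        · exact hc.1.2.2 A hAc B hBc
  rw [hc.eq_of_subset h (subset_insert _ _)]
  exact mem_insert_self _ _

theorem IsFullFlag.eq_of_flagInversions_eq (hc : IsFullFlag σ c) (hd : IsFullFlag σ d)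
    (hr : Set.InjOn r σ) (h : flagInversions r σ c = flagInversions r σ d) : c = d := by
  have hcomp : ∀ A ∈ c, ∀ B ∈ d, A ⊆ B ∨ B ⊆ A := by
    intro A hA B hB
    by_contra! hcon
    obtain ⟨⟨y, hyA, hyB⟩, x, hxB, hxA⟩ :=
      And.intro (not_subset.1 hcon.1) (not_subset.1 hcon.2)
    have hx := hd.1.2.1 B hB hxB
    have hy := hc.1.2.1 A hA hyA
    rcases lt_trichotomy (r x) (r y) with hlt | heq | hlt
    · have hxy : (x, y) ∈ flagInversions r σ c :=
        mem_flagInversions.2 ⟨⟨hx, hy⟩, hlt, A, hA, hyA, hxA⟩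
      rw [h, mem_flagInversions] at hxy
      obtain ⟨-, -, A', hA', hyA', hxA'⟩ := hxy
      rcases hd.1.2.2 A' hA' B hB with h' | h'
      · exact hyB (h' hyA')
      · exact hxA' (h' hxB)
    · exact hyB (hr hx hy heq ▸ hxB)
    · have hxy : (y, x) ∈ flagInversions r σ d :=
        mem_flagInversions.2 ⟨⟨hy, hx⟩, hlt, B, hB, hxB, hyB⟩
      rw [← h, mem_flagInversions] at hxy
      obtain ⟨-, -, A', hA', hxA', hyA'⟩ := hxy
      rcases hc.1.2.2 A' hA' A hA with h' | h'
      · exact hxA (h' hxA')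
      · exact hyA' (h' hyA)
  have hu : IsFlag σ (c ∪ d) := by
    refine ⟨?_, ?_, ?_⟩
    · simp [hc.1.1, hd.1.1]
    · intro A hA
      rcases mem_union.1 hA with hA | hA
      · exact hc.1.2.1 A hA
      · exact hd.1.2.1 A hA
    · intro A hA B hB
      rcases mem_union.1 hA with hA | hA <;> rcases mem_union.1 hB with hB | hB
      · exact hc.1.2.2 A hA B hB
      · exact hcomp A hA B hB
      · exact (hcomp B hB A hA).symm
      · exact hd.1.2.2 A hA B hB
  rw [hc.eq_of_subset hu subset_union_left]
  exact (hd.eq_of_subset hu subset_union_right).symm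

theorem self_notMem_flagDescents : σ ∉ flagDescents r σ c := by
  intro h
  refine (mem_filter.1 h).2 ((flagInversions_mono (erase_subset _ _)).antisymm ?_)
  rintro ⟨x, y⟩ hxy
  rw [mem_flagInversions] at hxy ⊢
  obtain ⟨h₁, h₂, A, hA, hy, hx⟩ := hxy
  exact ⟨h₁, h₂, A, mem_erase.2 ⟨fun h => hx (h ▸ h₁.1), hA⟩, hy, hx⟩

/-- Every inversion of a flag is detected by one of its descents. -/
theorem IsFlag.exists_mem_flagDescents (hc : IsFlag σ c) {x y : V}
    (hxy : (x, y) ∈ flagInversions r σ c) : ∃ A ∈ flagDescents r σ c, y ∈ A ∧ x ∉ A := by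
  induction hm : (c.filter (fun A => y ∈ A ∧ x ∉ A)).card using Nat.strong_induction_on
    generalizing x y with
  | _ m ih =>
  subst hm
  obtain ⟨⟨hx, hy⟩, hlt, A, hA, hyA, hxA⟩ := mem_flagInversions.1 hxy
  by_cases hdes : A ∈ flagDescents r σ c
  · exact ⟨A, hdes, hyA, hxA⟩
  have herase : flagInversions r σ (c.erase A) = flagInversions r σ c := by
    by_contra h
    exact hdes (mem_filter.2 ⟨hA, h⟩)
  rw [← herase, mem_flagInversions] at hxy
  obtain ⟨-, -, B, hB, hyB, hxB⟩ := hxy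
  obtain ⟨hBA, hB⟩ := mem_erase.1 hB
  have key : ∀ A B, A ∈ c → B ∈ c → B ≠ A → y ∈ A → x ∉ A → y ∈ B → x ∉ B → A ⊆ B →
      ∃ A ∈ flagDescents r σ c, y ∈ A ∧ x ∉ A := by
    clear hdes herase hyB hxB hBA hyA hxA
    intro A B hA hB hBA hyA hxA hyB hxB hAB
    obtain ⟨z, hzB, hzA⟩ : ∃ z ∈ B, z ∉ A := not_subset.1 fun h => hBA (h.antisymm hAB)
    have hz := hc.2.1 B hB hzB
    have h₁ : ∀ A' ∈ c, z ∈ A' → y ∈ A' := by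
      intro A' hA' hzA'
      rcases hc.2.2 A hA A' hA' with h | h
      · exact h hyA
      · exact absurd (h hzA') hzA
    have h₂ : ∀ A' ∈ c, z ∉ A' → x ∉ A' := by
      intro A' hA' hzA'
      rcases hc.2.2 B hB A' hA' with h | h
      · exact absurd (h hzB) hzA'
      · exact fun hx' => hxB (h hx')
    rcases lt_or_ge (r x) (r z) with hrz | hrz
    · obtain ⟨A', hA', hzA', hxA'⟩ := ih _ (card_lt_card (by
        rw [ssubset_iff_of_subset]
        · exact ⟨A, by simp [hA, hyA, hxA], by simp [hzA]⟩
        · intro A' hA'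
          rw [mem_filter] at hA' ⊢
          exact ⟨hA'.1, h₁ A' hA'.1 hA'.2.1, hA'.2.2⟩))
        (mem_flagInversions.2 ⟨⟨hx, hz⟩, hrz, B, hB, hzB, hxB⟩) rfl
      exact ⟨A', hA', h₁ A' (flagDescents_subset hA') hzA', hxA'⟩
    · obtain ⟨A', hA', hyA', hzA'⟩ := ih _ (card_lt_card (by
        rw [ssubset_iff_of_subset]
        · exact ⟨B, by simp [hB, hyB, hxB], by simp [hzB]⟩
        · intro A' hA'
          rw [mem_filter] at hA' ⊢
          exact ⟨hA'.1, hA'.2.1, h₂ A' hA'.1 hA'.2.2⟩))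
        (mem_flagInversions.2 ⟨⟨hz, hy⟩, hrz.trans_lt hlt, A, hA, hyA, hzA⟩) rfl
      exact ⟨A', hA', hyA', h₂ A' (flagDescents_subset hA') hzA'⟩
  rcases hc.2.2 A hA B hB with h | h
  · exact key A B hA hB hBA hyA hxA hyB hxB h
  · exact key B A hB hA hBA.symm hyB hxB hyA hxA h

theorem IsFlag.flagInversions_eq_iff (hd : IsFlag σ d) (h : c ⊆ d) :
    flagInversions r σ c = flagInversions r σ d ↔ flagDescents r σ d ⊆ c := by
  constructor
  · intro heq A hA
    by_contra hAc
    refine (mem_filter.1 hA).2 ((flagInversions_mono (erase_subset _ _)).antisymm ?_)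
    rw [← heq]
    exact flagInversions_mono fun B hB => mem_erase.2 ⟨fun hBA => hAc (hBA ▸ hB), h hB⟩
  · intro hsub
    refine (flagInversions_mono h).antisymm ?_
    rintro ⟨x, y⟩ hxy
    obtain ⟨A, hA, hyA, hxA⟩ := hd.exists_mem_flagDescents hxy
    obtain ⟨h₁, h₂, -⟩ := mem_flagInversions.1 hxy
    exact mem_flagInversions.2 ⟨h₁, h₂, A, hsub hA, hyA, hxA⟩

theorem flagInversions_empty : flagInversions r σ ∅ = ∅ := by
  simp [flagInversions]

theorem IsFlag.flagDescents_eq_empty_iff (hc : IsFlag σ c) :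
    flagDescents r σ c = ∅ ↔ flagInversions r σ c = ∅ := by
  rw [← subset_empty, ← hc.flagInversions_eq_iff (empty_subset _), flagInversions_empty,
    eq_comm]

theorem isFlag_empty : IsFlag σ ∅ := by simp [IsFlag]

/-- There is a complete flag all of whose proper members are descents. -/
theorem exists_isFullFlag_flagDescents_eq_erase (hr : Set.InjOn r σ) :
    ∃ c, IsFullFlag σ c ∧ flagDescents r σ c = c.erase σ := by
  obtain ⟨c, hc, -, hinv⟩ := (isFlag_empty (σ := σ)).exists_isFullFlag
    (r := fun x => OrderDual.toDual (r x)) (fun x hx y hy h => hr hx hy h)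
  rw [flagInversions_empty] at hinv
  have hno : ∀ A ∈ c, ∀ y ∈ A, ∀ x ∈ σ, x ∉ A → r x < r y := by
    intro A hA y hy x hx hxA
    have hyσ := hc.1.2.1 A hA hy
    refine lt_of_le_of_ne (not_lt.1 fun hlt => ?_) fun h => hxA (hr hx hyσ h ▸ hy)
    have : (x, y) ∈ flagInversions (fun x => OrderDual.toDual (r x)) σ c :=
      mem_flagInversions.2 ⟨⟨hx, hyσ⟩, hlt, A, hA, hy, hxA⟩
    rw [hinv] at this
    exact notMem_empty _ this
  refine ⟨c, hc, Subset.antisymm (fun A hA => mem_erase.2 ⟨?_, flagDescents_subset hA⟩) ?_⟩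
  · rintro rfl
    exact self_notMem_flagDescents hA
  intro A hA
  obtain ⟨hAσ, hA⟩ := mem_erase.1 hA
  have hsub := hc.1.2.1 A hA
  obtain ⟨y, hy, hymin⟩ := A.exists_min_image r
    (nonempty_iff_ne_empty.2 fun h => hc.1.1 (h ▸ hA))
  obtain ⟨x, hx, hxmax⟩ := (σ \ A).exists_max_image r
    (sdiff_nonempty.2 fun h => hAσ (hsub.antisymm h))
  obtain ⟨hx, hxA⟩ := mem_sdiff.1 hx
  refine mem_filter.2 ⟨hA, fun heq => ?_⟩
  have hxy : (x, y) ∈ flagInversions r σ c :=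
    mem_flagInversions.2 ⟨⟨hx, hsub hy⟩, hno A hA y hy x hx hxA, A, hA, hy, hxA⟩
  rw [← heq, mem_flagInversions] at hxy
  obtain ⟨-, -, B, hB, hyB, hxB⟩ := hxy
  obtain ⟨hBA, hB⟩ := mem_erase.1 hB
  refine hBA (Subset.antisymm (fun z hz => ?_) fun z hz => ?_)
  · by_contra hzA
    exact absurd (hno B hB z hz x hx hxB)
      (hxmax z (mem_sdiff.2 ⟨hc.1.2.1 B hB hz, hzA⟩)).not_gt
  · by_contra hzB
    exact absurd (hno B hB y hyB z (hsub hz) hzB) (hymin z hz).not_gt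

end Flags

/-! ### The tiles of the shelling -/

/-- `T` is a Morse tile on `C` whose faces are those which contain `R` and are not contained
in `μ`; it is the basic tile with restriction set `R` under the condition `b`. -/
def IsGluedTile (C R μ : Finset V) (v : V) (b : Prop) (T : MorseTile V) : Prop :=
  T.simplex = C ∧
    (∀ τ, τ ∈ T.faceSet ↔ τ ≠ ∅ ∧ τ ⊆ C ∧ R ⊆ τ ∧ ¬ τ ⊆ μ) ∧
    (b → T.morse = none ∧ T.res = R) ∧
    (¬ b → T.res = ∅ → R = ∅ ∧ μ ≠ C.erase v) ∧
    (¬ b → R ⊆ μ → μ = C.erase v → T.morse = none ∧ T.res = insert v R)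

theorem exists_isGluedTile {C R μ : Finset V} {v : V} {b : Prop} (hv : v ∈ C)
    (hR : R ⊆ C) (hμ : μ ⊆ C.erase v) (hb : b → μ = ∅) :
    ∃ T : MorseTile V, IsGluedTile C R μ v b T := by
  have hvμ : v ∉ μ := fun h => (mem_erase.1 (hμ h)).1 rfl
  by_cases hbR : b ∨ ¬ R ⊆ μ
  · refine ⟨⟨C, R, none, ⟨v, hv⟩, hR, by simp, by simp, by simp⟩, rfl, ?_, ?_, ?_, ?_⟩
    · intro τ
      simp only [MorseTile.faceSet, mem_filter, mem_powerset]
      constructor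
      · rintro ⟨h₁, h₂, h₃⟩
        refine ⟨h₃, h₁, h₂, fun h => ?_⟩
        rcases hbR with hb' | hb'
        · exact h₃ (subset_empty.1 (hb hb' ▸ h))
        · exact hb' (h₂.trans h)
      · rintro ⟨h₁, h₂, h₃, -⟩
        exact ⟨h₂, h₃, h₁⟩
    · exact fun _ => ⟨rfl, rfl⟩
    · intro hnb (hRe : R = ∅)
      subst hRe
      exact absurd (empty_subset μ) (hbR.resolve_left hnb)
    · intro hnb hRμ
      exact absurd hRμ (hbR.resolve_left hnb)
  push Not at hbR
  obtain ⟨hnb, hRμ⟩ := hbR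
  by_cases hμC : μ = C.erase v
  · refine ⟨⟨C, insert v R, none, ⟨v, hv⟩, insert_subset hv hR, by simp, by simp, by simp⟩,
      rfl, ?_, fun h => absurd h hnb, ?_, fun _ _ _ => ⟨rfl, rfl⟩⟩
    · intro τ
      simp only [MorseTile.faceSet, mem_filter, mem_powerset, insert_subset_iff]
      constructor
      · rintro ⟨h₁, ⟨h₂, h₃⟩, h₄⟩
        exact ⟨h₄, h₁, h₃, fun h => hvμ (h h₂)⟩
      · rintro ⟨h₁, h₂, h₃, h₄⟩
        refine ⟨h₂, ⟨?_, h₃⟩, h₁⟩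
        by_contra hvτ
        refine h₄ fun x hx => ?_
        rw [hμC]
        exact mem_erase.2 ⟨fun h => hvτ (h ▸ hx), h₂ hx⟩
    · intro _ (h : insert v R = ∅)
      exact absurd h (insert_ne_empty _ _)
  · have hcard : μ.card + 2 ≤ C.card := by
      have h₁ := card_lt_card (hμ.ssubset_of_ne hμC)
      have h₂ := card_erase_add_one hv
      omega
    have hμC' : μ ⊂ C := hμ.trans_ssubset (erase_ssubset hv)
    refine ⟨⟨C, R, some μ, ⟨v, hv⟩, hR, by simpa using hRμ, by simpa using hμC',
      by simpa using hcard⟩, rfl, ?_, fun h => absurd h hnb, ?_, fun _ _ h => absurd h hμC⟩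
    · intro τ
      simp only [MorseTile.faceSet, mem_filter, mem_powerset]
      constructor
      · rintro ⟨h₁, h₂, h₃⟩
        exact ⟨fun h => h₃ (h ▸ empty_subset _), h₁, h₂, h₃⟩
      · rintro ⟨-, h₂, h₃, h₄⟩
        exact ⟨h₂, h₃, h₄⟩
    · exact fun _ h => ⟨h, hμC⟩

/-! ### Ordering the facets of a strongly connected complex -/

theorem exists_injOn_lt_card {α : Type*} [DecidableEq α] (s : Finset α) :
    ∃ f : α → ℕ, Set.InjOn f s ∧ ∀ a ∈ s, f a < s.card :=
  ⟨fun x => s.toList.idxOf x,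
    fun x hx y _ h => (List.idxOf_inj (by simpa using hx)).1 h,
    fun a ha => by simpa using List.idxOf_lt_length_of_mem (mem_toList.2 ha)⟩

theorem exists_injOn_with_greatest (s : Finset V) (x : V) :
    ∃ r : V → ℕ, Set.InjOn r s ∧ ∀ y ∈ s, y ≠ x → r y < r x := by
  obtain ⟨f, hf, hlt⟩ := exists_injOn_lt_card s
  refine ⟨fun y => if y = x then s.card else f y, ?_, ?_⟩
  · intro y hy z hz h
    have h₁ := hlt y hy
    have h₂ := hlt z hz
    by_cases hyx : y = x <;> by_cases hzx : z = x <;> simp only [hyx, hzx, if_true, if_false] at h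
    · rw [hyx, hzx]
    · omega
    · omega
    · exact hf hy hz h
  · intro y hy hyx
    simpa [hyx] using hlt y hy

/-- The facets of a strongly connected pure complex can be ordered, starting from any of
them, in such a way that each other facet shares a codimension one face with a preceding one. -/
theorem StronglyConnected.exists_ordering {n : ℕ} {K : Finset (Finset V)}
    (hsc : StronglyConnected n K) (hpure : IsPureDim n K) {σ₀ : Finset V}
    (hσ₀ : IsFacetOf K σ₀) :
    ∃ p : Finset V → ℕ, (∀ σ σ', IsFacetOf K σ → IsFacetOf K σ' → p σ = p σ' → σ = σ') ∧
      (∀ σ, IsFacetOf K σ → p σ₀ ≤ p σ) ∧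
      ∀ σ, IsFacetOf K σ → σ ≠ σ₀ →
        ∃ σ', IsFacetOf K σ' ∧ p σ' < p σ ∧ ∃ x ∈ σ, σ.erase x ⊆ σ' := by
  classical
  obtain ⟨e, he, helt⟩ := exists_injOn_lt_card K
  let P : Finset V → ℕ → Prop := fun σ m => ∃ c : ℕ → Finset V, c 0 = σ₀ ∧ c m = σ ∧
    (∀ i ≤ m, IsFacetOf K (c i)) ∧ ∀ i < m, ∃ ρ : Finset V, ρ.card = n ∧ ρ ⊆ c i ∧ ρ ⊆ c (i + 1)
  have hP : ∀ σ, IsFacetOf K σ → ∃ m, P σ m := fun σ hσ => hsc σ₀ σ hσ₀ hσ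
  let d : Finset V → ℕ := fun σ => sInf {m | P σ m}
  have hd : ∀ σ, IsFacetOf K σ → P σ (d σ) := fun σ hσ => Nat.sInf_mem (hP σ hσ)
  have hdle : ∀ σ m, P σ m → d σ ≤ m := fun σ m h => Nat.sInf_le h
  have hlt : ∀ σ σ', IsFacetOf K σ → IsFacetOf K σ' → d σ' < d σ →
      d σ' * K.card + e σ' < d σ * K.card + e σ := by
    intro σ σ' hσ hσ' h
    have h₁ := helt σ' hσ'.1
    have h₂ : (d σ' + 1) * K.card ≤ d σ * K.card := Nat.mul_le_mul_right _ h
    linarith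
  have hd₀ : d σ₀ = 0 := by
    refine Nat.le_zero.1 (hdle _ _ ⟨fun _ => σ₀, rfl, rfl, fun _ _ => hσ₀, ?_⟩)
    simp
  have hdpos : ∀ σ, IsFacetOf K σ → σ ≠ σ₀ → 0 < d σ := by
    intro σ hσ hne
    by_contra! h
    obtain ⟨c, h₀, h₁, -⟩ := hd σ hσ
    rw [Nat.le_zero.1 h] at h₁
    exact hne (h₁.symm.trans h₀)
  refine ⟨fun σ => d σ * K.card + e σ, ?_, ?_, ?_⟩
  · intro σ σ' hσ hσ' h
    rcases lt_trichotomy (d σ) (d σ') with h' | h' | h'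
    · exact absurd h (hlt σ' σ hσ' hσ h').ne
    · refine he hσ.1 hσ'.1 ?_
      simp only [h'] at h
      omega
    · exact absurd h (hlt σ σ' hσ hσ' h').ne'
  · intro σ hσ
    by_cases h : σ = σ₀
    · rw [h]
    · exact (hlt σ σ₀ hσ hσ₀ (hd₀ ▸ hdpos σ hσ h)).le
  · intro σ hσ hne
    have hpos := hdpos σ hσ hne
    obtain ⟨c, h₀, h₁, hfac, hadj⟩ := hd σ hσ
    obtain ⟨m, hm⟩ : ∃ m, d σ = m + 1 := ⟨d σ - 1, by omega⟩
    rw [hm] at h₁ hfac hadj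
    have hcm : IsFacetOf K (c m) := hfac m (by omega)
    refine ⟨c m, hcm, hlt _ _ hσ hcm ?_, ?_⟩
    · have : d (c m) ≤ m := hdle _ _ ⟨c, h₀, rfl, fun i hi => hfac i (by omega),
        fun i hi => hadj i (by omega)⟩
      omega
    · obtain ⟨ρ, hρ, hρm, hρσ⟩ := hadj m (by omega)
      rw [h₁] at hρσ
      have hσn := hpure.2 σ hσ
      obtain ⟨x, hx, hxρ⟩ : ∃ x ∈ σ, x ∉ ρ := by
        refine not_subset.1 fun h => ?_
        have := card_le_card h
        omega
      refine ⟨x, hx, ?_⟩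
      have : ρ = σ.erase x := by
        refine eq_of_subset_of_card_le (fun y hy => mem_erase.2
          ⟨fun h => hxρ (h ▸ hy), hρσ hy⟩) ?_
        rw [card_erase_of_mem hx]
        omega
      rwa [← this]

theorem exists_isFacetOf_superset {K : Finset (Finset V)} {A : Finset V} (hA : A ∈ K) :
    ∃ σ, IsFacetOf K σ ∧ A ⊆ σ := by
  obtain ⟨σ, hσ, hmax⟩ := (K.filter (A ⊆ ·)).exists_max_image Finset.card
    ⟨A, mem_filter.2 ⟨hA, Subset.rfl⟩⟩
  rw [mem_filter] at hσ
  refine ⟨σ, ⟨hσ.1, fun θ hθ h => ?_⟩, hσ.2⟩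
  exact (eq_of_subset_of_card_le h (hmax θ (mem_filter.2 ⟨hθ, hσ.2.trans h⟩))).symm

/-- In a closed pseudo-manifold, every proper face of a facet lies in another facet. -/
theorem IsPseudoManifold.exists_other_facet {n : ℕ} {K : Finset (Finset V)}
    (hpm : IsPseudoManifold n K) {σ : Finset V} (hσ : IsFacetOf K σ) {x : V} (hx : x ∈ σ) :
    ∃ σ', IsFacetOf K σ' ∧ σ' ≠ σ ∧ σ.erase x ⊆ σ' := by
  have h := hpm.2.2 (σ.erase x) (hpm.1 σ hσ.1 _ (erase_subset _ _))
    (by rw [card_erase_of_mem hx, hpm.2.1.2 σ hσ]; rfl)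
  obtain ⟨σ', hσ', hne⟩ := exists_mem_ne (by rw [h]; norm_num) σ
  obtain ⟨-, hfacet, hsub⟩ := mem_filter.1 hσ'
  exact ⟨σ', hfacet, hne, hsub⟩

/-- the barycentric subdivision of a closed strongly connected
pseudo-manifold carries a shellable Morse tiling using a unique closed simplex,
at least one open simplex, and no other tile of order zero. -/
theorem pseudomanifold_barycentric_morse_shellable {V : Type*} [DecidableEq V]
    (n : ℕ) (K : Finset (Finset V))
    (hpm : IsPseudoManifold n K) (hsc : StronglyConnected n K) :
    ∃ ts : List (MorseTile (Finset V)),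
      IsMorseShelling (relFaces (barySd K) (∅ : Finset (Finset (Finset V)))) ts ∧
      (∃ T₀ ∈ ts, T₀.IsClosedSimplex ∧ T₀.order = 0 ∧
        ∀ T ∈ ts, T.order = 0 → T = T₀) ∧
      (∃ T ∈ ts, T.IsOpenSimplex) := by
  classical
  obtain ⟨σ₁, hσ₁, -⟩ := hpm.2.1.1
  obtain ⟨σ₀, hσ₀, -⟩ := exists_isFacetOf_superset hσ₁
  obtain ⟨p, hpinj, hpmin, hpadj⟩ := hsc.exists_ordering hpm.2.1 hσ₀
  have hne : ∀ σ, IsFacetOf K σ → σ.Nonempty := fun σ hσ =>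
    card_pos.1 (by rw [hpm.2.1.2 σ hσ]; omega)
  let old : Finset V → Finset V → Prop := fun σ A =>
    ∃ σ', IsFacetOf K σ' ∧ p σ' < p σ ∧ A ⊆ σ'
  have hnotold : ∀ σ, IsFacetOf K σ → ¬ old σ σ := by
    rintro σ hσ ⟨σ', hσ', hlt, hsub⟩
    rw [hσ.2 σ' hσ'.1 hsub] at hlt
    exact lt_irrefl _ hlt
  -- the vertices of each facet are ordered so that the first complete flag is glued
  -- along a codimension one face of a preceding facet
  have hrank : ∀ σ, ∃ r : V → ℕ, IsFacetOf K σ → Set.InjOn r σ ∧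
      (σ ≠ σ₀ → ∃ x ∈ σ, (∀ y ∈ σ, y ≠ x → r y < r x) ∧ old σ (σ.erase x)) := by
    intro σ
    by_cases hσ : IsFacetOf K σ
    · by_cases h : σ = σ₀
      · obtain ⟨x, -⟩ := hne σ hσ
        obtain ⟨r, hr, -⟩ := exists_injOn_with_greatest σ x
        exact ⟨r, fun _ => ⟨hr, fun h' => absurd h h'⟩⟩
      · obtain ⟨σ', hσ', hlt, x, hx, hsub⟩ := hpadj σ hσ h
        obtain ⟨r, hr, hmax⟩ := exists_injOn_with_greatest σ x
        exact ⟨r, fun _ => ⟨hr, fun _ => ⟨x, hx, hmax, σ', hσ', hlt, hsub⟩⟩⟩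
    · exact ⟨fun _ => 0, fun h => absurd h hσ⟩
  choose r hr using hrank
  let top : Finset (Finset V) → Finset V := fun C => C.sup id
  have htop : ∀ σ C, IsFacetOf K σ → IsFullFlag σ C → top C = σ := by
    intro σ C hσ hC
    refine Subset.antisymm (Finset.sup_le fun A hA => hC.1.2.1 A hA) ?_
    exact Finset.le_sup (f := id) (hC.self_mem (hne σ hσ))
  let Φ : Finset (Finset V) → ℕ ×ₗ ℕ := fun C =>
    toLex (p (top C), (flagInversions (r (top C)) (top C) C).card)
  let F : Finset (Finset (Finset V)) :=
    (barySd K).filter (fun C => ∃ σ, IsFacetOf K σ ∧ IsFullFlag σ C)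
  have hF : ∀ C, C ∈ F ↔ ∃ σ, IsFacetOf K σ ∧ IsFullFlag σ C := by
    intro C
    simp only [F, barySd, mem_filter, mem_powerset, and_iff_right_iff_imp]
    rintro ⟨σ, hσ, hC⟩
    exact ⟨fun A hA => hpm.1 σ hσ.1 A (hC.1.2.1 A hA), hC.1.1, hC.1.2.2⟩
  have hμsub : ∀ (σ : Finset V) (C : Finset (Finset V)), IsFacetOf K σ →
      C.filter (old σ) ⊆ C.erase σ := by
    intro σ C hσ A hA
    rw [mem_filter] at hA
    exact mem_erase.2 ⟨fun h => hnotold σ hσ (h ▸ hA.2), hA.1⟩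
  have htile : ∀ σ C, IsFacetOf K σ → IsFullFlag σ C → ∃ T : MorseTile (Finset V),
      IsGluedTile C (flagDescents (r σ) σ C) (C.filter (old σ)) σ (σ = σ₀) T :=
    fun σ C hσ hC => exists_isGluedTile (hC.self_mem (hne σ hσ)) flagDescents_subset
      (hμsub σ C hσ) (by
        rintro rfl
        rw [filter_eq_empty_iff]
        rintro A - ⟨σ', hσ', hlt, -⟩
        exact absurd (hpmin σ' hσ') hlt.not_ge)
  -- the first tile
  obtain ⟨C₀, hC₀, -, hinv₀⟩ :=
    (isFlag_empty (σ := σ₀)).exists_isFullFlag (hr σ₀ hσ₀).1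
  rw [flagInversions_empty] at hinv₀
  obtain ⟨T₀, -⟩ := htile σ₀ C₀ hσ₀ hC₀
  have htile' : ∀ C, ∃ T : MorseTile (Finset V), ∀ σ, IsFacetOf K σ → IsFullFlag σ C →
      IsGluedTile C (flagDescents (r σ) σ C) (C.filter (old σ)) σ (σ = σ₀) T := by
    intro C
    by_cases h : ∃ σ, IsFacetOf K σ ∧ IsFullFlag σ C
    · obtain ⟨σ, hσ, hC⟩ := h
      obtain ⟨T, hT⟩ := htile σ C hσ hC
      refine ⟨T, fun σ' hσ' hC' => ?_⟩
      obtain rfl : σ' = σ := (htop σ' C hσ' hC').symm.trans (htop σ C hσ hC)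
      exact hT
    · exact ⟨T₀, fun σ hσ hC => absurd ⟨σ, hσ, hC⟩ h⟩
  choose T hT using htile'
  have hS : ∀ τ, τ ∈ relFaces (barySd K) ∅ ↔ τ ≠ ∅ ∧ ∃ C ∈ F, τ ⊆ C := by
    intro τ
    simp only [relFaces, sdiff_empty, mem_filter, barySd, mem_powerset]
    constructor
    · rintro ⟨⟨hτK, hτ0, hτ⟩, hτe⟩
      refine ⟨hτe, ?_⟩
      obtain ⟨A, hA, hmax⟩ := IsFlag.exists_greatest (σ := τ.sup id)
        ⟨hτ0, fun A hA => Finset.le_sup (f := id) hA, hτ⟩ (nonempty_iff_ne_empty.2 hτe)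
      obtain ⟨σ, hσ, hAσ⟩ := exists_isFacetOf_superset (hτK hA)
      have hflag : IsFlag σ τ := ⟨hτ0, fun B hB => (hmax B hB).trans hAσ, hτ⟩
      obtain ⟨C, hC, hsub, -⟩ := hflag.exists_isFullFlag (hr σ hσ).1
      exact ⟨C, (hF C).2 ⟨σ, hσ, hC⟩, hsub⟩
    · rintro ⟨hτe, C, hC, hsub⟩
      obtain ⟨σ, hσ, hC⟩ := (hF C).1 hC
      have := hC.1.mono hsub
      exact ⟨⟨fun A hA => hpm.1 σ hσ.1 A (this.2.1 A hA), this.1, this.2.2⟩, hτe⟩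
  obtain ⟨ts, hts, hmem⟩ : ∃ ts : List (MorseTile (Finset V)),
      IsMorseShelling (relFaces (barySd K) ∅) ts ∧ ∀ t, t ∈ ts ↔ ∃ C ∈ F, T C = t := by
    refine exists_isMorseShelling_of_ordering _ F Φ T n ?_ ?_ ?_ hS
    · intro C hC
      obtain ⟨σ, hσ, hC⟩ := (hF C).1 hC
      rw [MorseTile.dim, (hT C σ hσ hC).1, hC.2, hpm.2.1.2 σ hσ]
      rfl
    · intro C hC τ hτ
      obtain ⟨σ, hσ, hC⟩ := (hF C).1 hC
      obtain ⟨hτe, hτC, hRτ, hτμ⟩ := ((hT C σ hσ hC).2.1 τ).1 hτ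
      refine ⟨hτe, hτC, fun C' hC' hne' hle hsub => ?_⟩
      obtain ⟨σ', hσ', hC'⟩ := (hF C').1 hC'
      simp only [Φ, htop σ C hσ hC, htop σ' C' hσ' hC', Prod.Lex.toLex_le_toLex] at hle
      rcases hle with hlt | ⟨heq, hle⟩
      · refine hτμ fun A hA => mem_filter.2 ⟨hτC hA, σ', hσ', hlt, hC'.1.2.1 A (hsub hA)⟩
      · obtain rfl := hpinj σ' σ hσ' hσ heq
        refine hne' (hC'.eq_of_flagInversions_eq hC (hr σ' hσ').1 ?_)
        refine (eq_of_subset_of_card_le ?_ hle).symm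
        rw [← (hC.1.flagInversions_eq_iff hτC).2 hRτ]
        exact flagInversions_mono hsub
    · intro C hC τ hτe hτC hnew
      obtain ⟨σ, hσ, hC⟩ := (hF C).1 hC
      refine ((hT C σ hσ hC).2.1 τ).2 ⟨hτe, hτC, ?_, fun hτμ => ?_⟩
      · obtain ⟨D, hD, hτD, hinv⟩ := (hC.1.mono hτC).exists_isFullFlag (hr σ hσ).1
        by_contra hR
        refine hnew D ((hF D).2 ⟨σ, hσ, hD⟩) ?_ hτD
        simp only [Φ, htop σ C hσ hC, htop σ D hσ hD, Prod.Lex.toLex_lt_toLex]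
        refine Or.inr ⟨trivial, ?_⟩
        rw [hinv]
        refine card_lt_card ((flagInversions_mono hτC).ssubset_of_ne fun h => hR ?_)
        exact (hC.1.flagInversions_eq_iff hτC).1 h
      · have hτflag := hC.1.mono hτC
        obtain ⟨A, hA, hmax⟩ := hτflag.exists_greatest (nonempty_iff_ne_empty.2 hτe)
        obtain ⟨σ', hσ', hlt, hAσ'⟩ := (mem_filter.1 (hτμ hA)).2
        have hτ' : IsFlag σ' τ := ⟨hτflag.1, fun B hB => (hmax B hB).trans hAσ', hτflag.2.2⟩
        obtain ⟨D, hD, hτD, -⟩ := hτ'.exists_isFullFlag (hr σ' hσ').1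
        refine hnew D ((hF D).2 ⟨σ', hσ', hD⟩) ?_ hτD
        simp only [Φ, htop σ C hσ hC, htop σ' D hσ' hD, Prod.Lex.toLex_lt_toLex]
        exact Or.inl hlt
  refine ⟨ts, hts, ?_, ?_⟩
  · have hR₀ := hC₀.1.flagDescents_eq_empty_iff.2 hinv₀
    obtain ⟨hm, hres⟩ := (hT C₀ σ₀ hσ₀ hC₀).2.2.1 rfl
    rw [hR₀] at hres
    refine ⟨T C₀, (hmem _).2 ⟨C₀, (hF C₀).2 ⟨σ₀, hσ₀, hC₀⟩, rfl⟩, ⟨hm, hres⟩, ?_, ?_⟩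
    · rw [MorseTile.order, hres, card_empty]
    · intro t ht ht0
      obtain ⟨C, hC, rfl⟩ := (hmem t).1 ht
      obtain ⟨σ, hσ, hC⟩ := (hF C).1 hC
      rw [MorseTile.order, card_eq_zero] at ht0
      obtain ⟨-, -, hbase, hother, -⟩ := hT C σ hσ hC
      by_cases h : σ = σ₀
      · subst h
        rw [(hbase rfl).2, hC.1.flagDescents_eq_empty_iff] at ht0
        rw [hC.eq_of_flagInversions_eq hC₀ (hr σ hσ).1 (ht0.trans hinv₀.symm)]
      · obtain ⟨hR, hμ⟩ := hother h ht0
        refine absurd ((hμsub σ C hσ).antisymm fun A hA => ?_) hμ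
        obtain ⟨hAσ, hAC⟩ := mem_erase.1 hA
        obtain ⟨x, hx, hmax, σ', hσ', hlt, hsub⟩ := (hr σ hσ).2 h
        refine mem_filter.2 ⟨hAC, σ', hσ', hlt, Subset.trans (fun y hy => ?_) hsub⟩
        refine mem_erase.2 ⟨?_, hC.1.2.1 A hAC hy⟩
        rintro rfl
        obtain ⟨z, hz, hzA⟩ := not_subset.1 fun h => hAσ ((hC.1.2.1 A hAC).antisymm h)
        have hzy : (z, y) ∈ flagInversions (r σ) σ C := mem_flagInversions.2
          ⟨⟨hz, hx⟩, hmax z hz fun h => hzA (h ▸ hy), A, hAC, hy, hzA⟩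
        rw [hC.1.flagDescents_eq_empty_iff.1 hR] at hzy
        exact notMem_empty _ hzy
  -- the last facet contributes an open simplex
  · obtain ⟨σ, hσ, hmax⟩ := (K.filter (IsFacetOf K)).exists_max_image p
      ⟨σ₀, mem_filter.2 ⟨hσ₀.1, hσ₀⟩⟩
    replace hσ := (mem_filter.1 hσ).2
    have hold : ∀ x ∈ σ, old σ (σ.erase x) := by
      intro x hx
      obtain ⟨σ', hσ', hne', hsub⟩ := hpm.exists_other_facet hσ hx
      exact ⟨σ', hσ', lt_of_le_of_ne (hmax σ' (mem_filter.2 ⟨hσ'.1, hσ'⟩))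
        fun h => hne' (hpinj _ _ hσ' hσ h), hsub⟩
    have hσσ₀ : σ ≠ σ₀ := by
      rintro rfl
      obtain ⟨x, hx⟩ := hne σ hσ
      obtain ⟨σ', hσ', hlt, -⟩ := hold x hx
      exact absurd (hpmin σ' hσ') hlt.not_ge
    obtain ⟨C, hC, hdes⟩ := exists_isFullFlag_flagDescents_eq_erase (hr σ hσ).1
    have hμ : C.filter (old σ) = C.erase σ := by
      refine (hμsub σ C hσ).antisymm fun A hA => ?_
      obtain ⟨hAσ, hAC⟩ := mem_erase.1 hA
      have hAsub := hC.1.2.1 A hAC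
      obtain ⟨x, hx, hxA⟩ := not_subset.1 fun h => hAσ (hAsub.antisymm h)
      obtain ⟨σ', hσ', hlt, hsub⟩ := hold x hx
      exact mem_filter.2 ⟨hAC, σ', hσ', hlt, Subset.trans
        (fun y hy => mem_erase.2 ⟨fun h : y = x => hxA (h ▸ hy), hAsub hy⟩) hsub⟩
    obtain ⟨hsimp, -, -, -, hopen⟩ := hT C σ hσ hC
    obtain ⟨hm, hres⟩ := hopen hσσ₀ (by rw [hdes, hμ]) hμ
    refine ⟨T C, (hmem _).2 ⟨C, (hF C).2 ⟨σ, hσ, hC⟩, rfl⟩, hm, ?_⟩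
    rw [hres, hdes, hsimp, insert_erase (hC.self_mem (hne σ hσ))]
end

section
/- Let σ_1 and σ_2 be two finite sets whose intersection μ = σ_1 ∩ σ_2 is nonempty and has codimension at least two in each, i.e. card(μ) ≤ card(σ_i) − 2 for i = 1, 2, and let K be the finite simplicial complex consisting of all subsets of σ_1 together with all subsets of σ_2. Then K carries no h-tiling. -/
open Finset

variable {V : Type*} [DecidableEq V]

namespace MorseTile

theorem subset_simplex {T : MorseTile V} {τ : Finset V} (h : τ ∈ T.faceSet) :
    τ ⊆ T.simplex := by
  unfold faceSet at h
  split at h <;> simp_all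

theorem res_subset {T : MorseTile V} {τ : Finset V} (h : τ ∈ T.faceSet) : T.res ⊆ τ := by
  unfold faceSet at h
  split at h <;> simp_all

theorem simplex_mem_faceSet (T : MorseTile V) : T.simplex ∈ T.faceSet := by
  unfold faceSet
  split
  · simpa [T.res_sub] using T.simplex_nonempty.ne_empty
  · rename_i μ hμ
    simpa [T.res_sub] using (T.morse_ssub μ hμ).2

theorem IsHTile.mem_faceSet_of_res_eq_empty {T : MorseTile V} (hT : T.IsHTile)
    (hres : T.res = ∅) {τ : Finset V} (hτ : τ ⊆ T.simplex) (hne : τ.Nonempty) :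
    τ ∈ T.faceSet := by
  rcases hT with h | h <;> simp [faceSet, h, hres, hτ, hne.ne_empty]

end MorseTile

theorem mem_relFaces_powerset_union {σ₁ σ₂ τ : Finset V} :
    τ ∈ relFaces (σ₁.powerset ∪ σ₂.powerset) ∅ ↔ (τ ⊆ σ₁ ∨ τ ⊆ σ₂) ∧ τ ≠ ∅ := by
  simp [relFaces]

theorem IsMorseTiling.eq_of_mem {S : Finset (Finset V)} {ts : List (MorseTile V)}
    (h : IsMorseTiling S ts) {T T' : MorseTile V} (hT : T ∈ ts) (hT' : T' ∈ ts)
    {τ : Finset V} (hτ : τ ∈ T.faceSet) (hτ' : τ ∈ T'.faceSet) : T = T' := by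
  by_contra hne
  have : Std.Symm (fun T T' : MorseTile V => Disjoint T.faceSet T'.faceSet) :=
    ⟨fun _ _ h => h.symm⟩
  exact Finset.disjoint_left.1 (h.1.forall hT hT' hne) hτ hτ'

/-- In a Morse tiling of the union of two simplices, a vertex of the first simplex outside the
second one lies in a tile whose underlying simplex is the whole first simplex. -/
theorem IsMorseTiling.exists_simplex_eq {σ₁ σ₂ : Finset V} {ts : List (MorseTile V)}
    (h : IsMorseTiling (relFaces (σ₁.powerset ∪ σ₂.powerset) ∅) ts)
    {v : V} (hv₁ : v ∈ σ₁) (hv₂ : v ∉ σ₂) :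
    ∃ T ∈ ts, T.simplex = σ₁ ∧ {v} ∈ T.faceSet := by
  have hσ : σ₁ ∈ relFaces (σ₁.powerset ∪ σ₂.powerset) ∅ :=
    mem_relFaces_powerset_union.2 ⟨.inl subset_rfl, Finset.ne_empty_of_mem hv₁⟩
  rw [← h.2.1] at hσ
  obtain ⟨T₀, hT₀, hσT₀⟩ := mem_faceUnion.1 hσ
  have hdim : σ₁.card - 1 ≤ T₀.dim :=
    Nat.sub_le_sub_right (Finset.card_le_card (MorseTile.subset_simplex hσT₀)) 1
  have hvσ : ({v} : Finset V) ⊆ σ₁ := by simpa using hv₁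
  have hvT := h.2.2 (σ₁.card - 1) {v}
    (mem_relFaces_powerset_union.2 ⟨.inl hvσ, Finset.singleton_ne_empty v⟩)
    (Finset.singleton_ne_empty v) σ₁
    (mem_faceUnion.2 ⟨T₀, List.mem_filter.2 ⟨hT₀, by simpa using hdim⟩, hσT₀⟩) hvσ
  obtain ⟨T, hT, hvT⟩ := mem_faceUnion.1 hvT
  obtain ⟨hT, hd⟩ := List.mem_filter.1 hT
  refine ⟨T, hT, ?_, hvT⟩
  have hTS : T.simplex ∈ relFaces (σ₁.powerset ∪ σ₂.powerset) ∅ := by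
    rw [← h.2.1]
    exact mem_faceUnion.2 ⟨T, hT, T.simplex_mem_faceSet⟩
  have hvs : v ∈ T.simplex := MorseTile.subset_simplex hvT (Finset.mem_singleton_self v)
  have hsub : T.simplex ⊆ σ₁ :=
    (mem_relFaces_powerset_union.1 hTS).1.resolve_right fun h' => hv₂ (h' hvs)
  refine Finset.eq_of_subset_of_card_le hsub ?_
  have hpos := T.simplex_nonempty.card_pos
  have hd' : σ₁.card - 1 ≤ T.simplex.card - 1 := of_decide_eq_true hd
  omega

/-- In an h-tiling of the union of two simplices, if the first one has at least two vertices
outside the second, then the tile supported on it is the closed simplex. -/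
theorem IsHTiling.exists_mem_faceSet {σ₁ σ₂ : Finset V} {ts : List (MorseTile V)}
    (h : IsHTiling (relFaces (σ₁.powerset ∪ σ₂.powerset) ∅) ts)
    (hcard : (σ₁ ∩ σ₂).card + 2 ≤ σ₁.card) :
    ∃ T ∈ ts, T.simplex = σ₁ ∧ ∀ τ ⊆ σ₁, τ.Nonempty → τ ∈ T.faceSet := by
  have hlt : 1 < (σ₁ \ σ₂).card := by
    have := Finset.card_sdiff_add_card_inter σ₁ σ₂
    omega
  obtain ⟨v, hv, w, hw, hvw⟩ := Finset.one_lt_card.1 hlt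
  rw [Finset.mem_sdiff] at hv hw
  obtain ⟨T, hT, hTσ, hvT⟩ := h.1.exists_simplex_eq hv.1 hv.2
  obtain ⟨T', hT', hTσ', hwT⟩ := h.1.exists_simplex_eq hw.1 hw.2
  obtain rfl : T = T' := h.1.eq_of_mem hT hT' (τ := σ₁)
    (hTσ ▸ T.simplex_mem_faceSet) (hTσ' ▸ T'.simplex_mem_faceSet)
  have hres : T.res = ∅ := Finset.subset_empty.1 <|
    (Finset.disjoint_singleton.2 hvw) (MorseTile.res_subset hvT) (MorseTile.res_subset hwT)
  exact ⟨T, hT, hTσ, fun τ hτ hne =>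
    (h.2 T hT).mem_faceSet_of_res_eq_empty hres (hTσ ▸ hτ) hne⟩

/-- two simplices sharing a nonempty common face of codimension at
least two in each carry no h-tiling. -/
theorem two_simplices_sharing_codim_two_face_not_htileable
    {V : Type*} [DecidableEq V] (σ₁ σ₂ : Finset V)
    (hne : (σ₁ ∩ σ₂).Nonempty)
    (h1 : (σ₁ ∩ σ₂).card + 2 ≤ σ₁.card) (h2 : (σ₁ ∩ σ₂).card + 2 ≤ σ₂.card) :
    ¬ ∃ ts : List (MorseTile V),
        IsHTiling (relFaces (σ₁.powerset ∪ σ₂.powerset) ∅) ts := by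
  rintro ⟨ts, h⟩
  obtain ⟨T₁, hT₁, hσ₁, hf₁⟩ := h.exists_mem_faceSet h1
  obtain ⟨T₂, hT₂, hσ₂, hf₂⟩ := IsHTiling.exists_mem_faceSet
    (by rwa [Finset.union_comm] at h) (by rwa [Finset.inter_comm] at h2)
  have heq : T₁ = T₂ := h.1.eq_of_mem hT₁ hT₂
    (hf₁ _ Finset.inter_subset_left hne) (hf₂ _ Finset.inter_subset_right hne)
  have hσ : σ₁ = σ₂ := by rw [← hσ₁, ← hσ₂, heq]
  rw [hσ, Finset.inter_self] at h2
  omega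
end
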